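/- arXiv:2003.07256 — 4 statements merged into one kernel-verified Lean document; each statement's English description precedes it below -/
import Mathlib

section
/- Let f : U → ℝ³ with unit normal ν be a frontal in orthogonal adapted coordinates (u,v) around a non-front singular point at the origin (Ñ(0,0) = 0), and suppose the limiting normal curvature vanishes along the singular curve: L̃(u,0) = 0 for all u (this holds whenever the Gaussian curvature K is bounded near the origin). Then, writing L̃ = v·L̃₁ for a smooth function L̃₁ (division lemma), the Gaussian curvature satisfies K = (L̃₁Ñ − M̃²)/(ẼG̃ − F̃²) on {v ≠ 0}; consequently K extends continuously to U with extended value K(0,0) = −κ_t(0)² ≤ 0 at the origin. In particular K(0,0) = 0 if and only if κ_t(0) = 0. -/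
noncomputable section

open Matrix Set
open scoped ContDiff

abbrev V3 : Type := Fin 3 → ℝ

/-- Partial derivative in the `u`-direction. -/
def Du {E : Type*} [NormedAddCommGroup E] [NormedSpace ℝ E] (g : ℝ × ℝ → E) (p : ℝ × ℝ) : E :=
  fderiv ℝ g p (1, 0)

/-- Partial derivative in the `v`-direction. -/
def Dv {E : Type*} [NormedAddCommGroup E] [NormedSpace ℝ E] (g : ℝ × ℝ → E) (p : ℝ × ℝ) : E :=
  fderiv ℝ g p (0, 1)

def det3 (a b c : V3) : ℝ := Matrix.det (Matrix.of ![a, b, c])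

def dot (x y : V3) : ℝ := x ⬝ᵥ y

def nrm (x : V3) : ℝ := Real.sqrt (dot x x)

def cross3 (x y : V3) : V3 := crossProduct x y

structure FrontalData where
  f : ℝ × ℝ → V3
  nu : ℝ × ℝ → V3
  h : ℝ × ℝ → V3

namespace FrontalData

def Et (X : FrontalData) (p : ℝ × ℝ) : ℝ := dot (Du X.f p) (Du X.f p)
def Ft (X : FrontalData) (p : ℝ × ℝ) : ℝ := dot (Du X.f p) (X.h p)
def Gt (X : FrontalData) (p : ℝ × ℝ) : ℝ := dot (X.h p) (X.h p)
def Lt (X : FrontalData) (p : ℝ × ℝ) : ℝ := -(dot (Du X.f p) (Du X.nu p))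
def Mt (X : FrontalData) (p : ℝ × ℝ) : ℝ := -(dot (X.h p) (Du X.nu p))
def Nt (X : FrontalData) (p : ℝ × ℝ) : ℝ := -(dot (X.h p) (Dv X.nu p))

def EGF (X : FrontalData) (p : ℝ × ℝ) : ℝ := X.Et p * X.Gt p - (X.Ft p) ^ 2

/-- `f` is a frontal with unit normal `nu`, in adapted coordinates around a singular point of
the first kind at the origin: `f_v = v • h` and `{f_u, h, nu}` is a frame. -/
def IsAdapted (X : FrontalData) (U : Set (ℝ × ℝ)) : Prop :=
  IsOpen U ∧ (0, 0) ∈ U ∧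
  ContDiff ℝ ∞ X.f ∧ ContDiff ℝ ∞ X.nu ∧ ContDiff ℝ ∞ X.h ∧
  (∀ p ∈ U, dot (X.nu p) (X.nu p) = 1) ∧
  (∀ p ∈ U, dot (Du X.f p) (X.nu p) = 0) ∧
  (∀ p ∈ U, dot (Dv X.f p) (X.nu p) = 0) ∧
  (∀ p ∈ U, Dv X.f p = p.2 • X.h p) ∧
  (∀ p ∈ U, det3 (Du X.f p) (X.h p) (X.nu p) ≠ 0) ∧
  (∀ p ∈ U, 0 < X.EGF p)

/-- orthogonal adapted coordinates -/
def IsOrthogonal (X : FrontalData) (U : Set (ℝ × ℝ)) : Prop :=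
  ∀ u : ℝ, (u, 0) ∈ U → X.Et (u, 0) = 1 ∧ X.Gt (u, 0) = 1 ∧ X.Ft (u, 0) = 0

/-- Gaussian curvature on `{v ≠ 0}`. -/
def Kdef (X : FrontalData) (p : ℝ × ℝ) : ℝ :=
  (X.Lt p * X.Nt p - p.2 * (X.Mt p) ^ 2) / (p.2 * X.EGF p)

/-- Mean curvature on `{v ≠ 0}`. -/
def Hdef (X : FrontalData) (p : ℝ × ℝ) : ℝ :=
  (X.Et p * X.Nt p - 2 * p.2 * X.Ft p * X.Mt p + p.2 * X.Gt p * X.Lt p) / (2 * p.2 * X.EGF p)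

/-- Principal curvatures on `{v ≠ 0}`. -/
def kap1 (X : FrontalData) (p : ℝ × ℝ) : ℝ := X.Hdef p + Real.sqrt ((X.Hdef p) ^ 2 - X.Kdef p)
def kap2 (X : FrontalData) (p : ℝ × ℝ) : ℝ := X.Hdef p - Real.sqrt ((X.Hdef p) ^ 2 - X.Kdef p)

/-- Limiting normal curvature along the singular curve. -/
def kapNu (X : FrontalData) (u : ℝ) : ℝ := X.Lt (u, 0)
/-- Cuspidal torsion along the singular curve. -/
def kapT (X : FrontalData) (u : ℝ) : ℝ := X.Mt (u, 0)
/-- Bias along the singular curve. -/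
def rb (X : FrontalData) (u : ℝ) : ℝ := 3 * Dv X.Nt (u, 0)
/-- Secondary cuspidal curvature along the singular curve. -/
def rc (X : FrontalData) (u : ℝ) : ℝ :=
  12 * (Dv (Dv X.Nt) (u, 0) - 4 * Dv X.Ft (u, 0) * X.Mt (u, 0) -
    2 * Dv X.Gt (u, 0) * Dv X.Nt (u, 0))

end FrontalData

/-- Directional derivative of a map along the vector field `a ∂_u + ∂_v`. -/
def etaD (a : ℝ × ℝ → ℝ) (g : ℝ × ℝ → V3) : ℝ × ℝ → V3 :=
  fun p => a p • Du g p + Dv g p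

theorem hasFDerivAt_intervalIntegral_of_contDiff {H : Type*} [NormedAddCommGroup H]
    [NormedSpace ℝ H] [FiniteDimensional ℝ H] {F : H × ℝ → ℝ} (hF : ContDiff ℝ ∞ F)
    (a b : ℝ) (x₀ : H) :
    HasFDerivAt (fun x => ∫ t in a..b, F (x, t))
      (∫ t in a..b, (fderiv ℝ F (x₀, t)).comp (ContinuousLinearMap.inl ℝ H ℝ)) x₀ := by
  have hF' : Continuous fun q : H × ℝ =>
      (fderiv ℝ F q).comp (ContinuousLinearMap.inl ℝ H ℝ) := by
    have := hF.continuous_fderiv (by simp)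
    fun_prop
  have hFc : Continuous F := hF.continuous
  have : ProperSpace H := FiniteDimensional.proper ℝ H
  obtain ⟨C, hC⟩ := ((isCompact_closedBall x₀ 1).prod (isCompact_uIcc (a := a) (b := b)))
    |>.exists_bound_of_continuousOn hF'.continuousOn
  refine intervalIntegral.hasFDerivAt_integral_of_dominated_of_fderiv_le
    (F := fun x t => F (x, t))
    (F' := fun x t => (fderiv ℝ F (x, t)).comp (ContinuousLinearMap.inl ℝ H ℝ))
    (bound := fun _ => C)
    (Metric.closedBall_mem_nhds x₀ one_pos) ?_ ?_ ?_ ?_ ?_ ?_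
  · exact .of_forall fun x => Continuous.aestronglyMeasurable (by fun_prop)
  · exact Continuous.intervalIntegrable (by fun_prop) _ _
  · exact Continuous.aestronglyMeasurable (hF'.comp (by fun_prop : Continuous fun t => (x₀, t)))
  · exact .of_forall fun t ht x hx => hC (x, t) ⟨hx, uIoc_subset_uIcc ht⟩
  · exact intervalIntegrable_const
  · refine .of_forall fun t _ x _ => ?_
    exact ((hF.differentiable (by simp)) (x, t)).hasFDerivAt.comp x (hasFDerivAt_prodMk_left x t)

/-- Integrals of a smooth function over a fixed interval depend smoothly on parameters. -/
theorem contDiff_intervalIntegral {H : Type*} [NormedAddCommGroup H]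
    [NormedSpace ℝ H] [FiniteDimensional ℝ H] {F : H × ℝ → ℝ} (hF : ContDiff ℝ ∞ F)
    (a b : ℝ) : ContDiff ℝ ∞ fun x => ∫ t in a..b, F (x, t) := by
  rw [contDiff_infty]
  intro n
  induction n generalizing F with
  | zero =>
    exact contDiff_zero.2 (continuous_iff_continuousAt.2 fun x =>
      (hasFDerivAt_intervalIntegral_of_contDiff hF a b x).continuousAt)
  | succ n ih =>
    push_cast
    rw [contDiff_succ_iff_fderiv_apply]
    refine ⟨fun x => (hasFDerivAt_intervalIntegral_of_contDiff hF a b x).differentiableAt,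
      by simp, fun y => ?_⟩
    have hd : ContDiff ℝ ∞ (fderiv ℝ F) := (contDiff_infty_iff_fderiv.1 hF).2
    have hG : ContDiff ℝ ∞ fun q : H × ℝ => fderiv ℝ F q (y, 0) := hd.clm_apply contDiff_const
    convert ih hG using 2 with x
    rw [(hasFDerivAt_intervalIntegral_of_contDiff hF a b x).fderiv,
      ContinuousLinearMap.intervalIntegral_apply]
    · simp
    · have := hd.continuous
      exact Continuous.intervalIntegrable (by fun_prop) _ _

/-- **Division lemma**: a smooth function is, up to its values on `{v = 0}`, divisible by `v`. -/
theorem exists_contDiff_sub_eq_mul {g : ℝ × ℝ → ℝ} (hg : ContDiff ℝ ∞ g) :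
    ∃ g₁ : ℝ × ℝ → ℝ, ContDiff ℝ ∞ g₁ ∧ ∀ p, g p - g (p.1, 0) = p.2 * g₁ p := by
  have hd : ContDiff ℝ ∞ (fderiv ℝ g) := (contDiff_infty_iff_fderiv.1 hg).2
  have hF : ContDiff ℝ ∞ fun q : (ℝ × ℝ) × ℝ => fderiv ℝ g (q.1.1, q.2 * q.1.2) (0, 1) :=
    (hd.comp (by fun_prop)).clm_apply contDiff_const
  refine ⟨_, contDiff_intervalIntegral hF 0 1, fun p => ?_⟩
  have hderiv (t : ℝ) : HasDerivAt (fun t => g (p.1, t * p.2))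
      (p.2 * fderiv ℝ g (p.1, t * p.2) (0, 1)) t := by
    have h₁ : HasDerivAt (fun t : ℝ => (p.1, t * p.2)) (0, 1 * p.2) t :=
      (hasDerivAt_const t p.1).prodMk ((hasDerivAt_id t).mul_const p.2)
    have h₂ := ((hg.differentiable (by simp)) (p.1, t * p.2)).hasFDerivAt.comp_hasDerivAt t h₁
    have h₃ : fderiv ℝ g (p.1, t * p.2) (0, 1 * p.2) =
        p.2 * fderiv ℝ g (p.1, t * p.2) (0, 1) := by
      simpa using map_smul (fderiv ℝ g (p.1, t * p.2)) p.2 ((0, 1) : ℝ × ℝ)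
    rwa [h₃] at h₂
  have hcont : Continuous fun t : ℝ => fderiv ℝ g (p.1, t * p.2) (0, 1) := by
    have := hd.continuous
    fun_prop
  have := intervalIntegral.integral_eq_sub_of_hasDerivAt (a := 0) (b := 1)
    (fun t _ => hderiv t) (Continuous.intervalIntegrable (by fun_prop) _ _)
  rw [intervalIntegral.integral_const_mul] at this
  simpa using this.symm

theorem ContDiff.dot {g k : ℝ × ℝ → V3} (hg : ContDiff ℝ ∞ g) (hk : ContDiff ℝ ∞ k) :
    ContDiff ℝ ∞ fun p => dot (g p) (k p) := by
  have hg' := contDiff_pi.1 hg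
  have hk' := contDiff_pi.1 hk
  have : ContDiff ℝ ∞ fun p => ∑ i, g p i * k p i :=
    ContDiff.sum fun i _ => (hg' i).mul (hk' i)
  exact this

theorem ContDiff.Du {g : ℝ × ℝ → V3} (hg : ContDiff ℝ ∞ g) : ContDiff ℝ ∞ (Du g) :=
  (contDiff_infty_iff_fderiv.1 hg).2.clm_apply contDiff_const

theorem ContDiff.Dv {g : ℝ × ℝ → V3} (hg : ContDiff ℝ ∞ g) : ContDiff ℝ ∞ (Dv g) :=
  (contDiff_infty_iff_fderiv.1 hg).2.clm_apply contDiff_const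

/-- if the limiting normal curvature vanishes along the singular curve through a
non-front singular point, then writing `L̃ = v·L̃₁`, the Gaussian curvature equals
`(L̃₁Ñ − M̃²)/(ẼG̃ − F̃²)` on `{v ≠ 0}`, extends continuously to `U` with value
`−κ_t(0)² ≤ 0` at the origin, which vanishes iff `κ_t(0) = 0`. -/
theorem stmt15 (X : FrontalData) (U : Set (ℝ × ℝ))
    (hA : X.IsAdapted U) (hO : X.IsOrthogonal U)
    (hstar : ∀ p ∈ U, ∀ t : ℝ, t ∈ Set.Icc (0 : ℝ) 1 → ((p.1, t * p.2) : ℝ × ℝ) ∈ U)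
    (hnf : X.Nt (0, 0) = 0)
    (hL : ∀ u : ℝ, (u, 0) ∈ U → X.Lt (u, 0) = 0) :
    ∃ L1 : ℝ × ℝ → ℝ, ContDiffOn ℝ ∞ L1 U ∧
      (∀ p ∈ U, X.Lt p = p.2 * L1 p) ∧
      (∀ p ∈ U, p.2 ≠ 0 → X.Kdef p = (L1 p * X.Nt p - (X.Mt p) ^ 2) / X.EGF p) ∧
      ContinuousOn (fun p => (L1 p * X.Nt p - (X.Mt p) ^ 2) / X.EGF p) U ∧
      (L1 (0, 0) * X.Nt (0, 0) - (X.Mt (0, 0)) ^ 2) / X.EGF (0, 0) = -(X.kapT 0) ^ 2 ∧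
      (L1 (0, 0) * X.Nt (0, 0) - (X.Mt (0, 0)) ^ 2) / X.EGF (0, 0) ≤ 0 ∧
      ((L1 (0, 0) * X.Nt (0, 0) - (X.Mt (0, 0)) ^ 2) / X.EGF (0, 0) = 0 ↔ X.kapT 0 = 0) := by
  obtain ⟨-, h0, hf, hnu, hh, -, -, -, -, -, hpos⟩ := hA
  have hLs : ContDiff ℝ ∞ X.Lt := (hf.Du.dot hnu.Du).neg
  have hMs : ContDiff ℝ ∞ X.Mt := (hh.dot hnu.Du).neg
  have hNs : ContDiff ℝ ∞ X.Nt := (hh.dot hnu.Dv).neg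
  have hEs : ContDiff ℝ ∞ X.EGF :=
    ((hf.Du.dot hf.Du).mul (hh.dot hh)).sub ((hf.Du.dot hh).pow 2)
  obtain ⟨L1, hL1s, hL1⟩ := exists_contDiff_sub_eq_mul hLs
  have hLt : ∀ p ∈ U, X.Lt p = p.2 * L1 p := fun p hp => by
    have hp0 : (p.1, (0 : ℝ)) ∈ U := by simpa using hstar p hp 0 (by simp)
    rw [← hL1 p, hL p.1 hp0, sub_zero]
  have hval : (L1 (0, 0) * X.Nt (0, 0) - (X.Mt (0, 0)) ^ 2) / X.EGF (0, 0) = -(X.kapT 0) ^ 2 := by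
    obtain ⟨hE, hG, hF⟩ := hO 0 h0
    simp [FrontalData.EGF, FrontalData.kapT, hE, hG, hF, hnf]
  refine ⟨L1, hL1s.contDiffOn, hLt, fun p hp hv => ?_, ?_, hval, ?_, ?_⟩
  · rw [FrontalData.Kdef, hLt p hp, mul_assoc, ← mul_sub, mul_div_mul_left _ _ hv]
  · exact (((hL1s.mul hNs).sub (hMs.pow 2)).continuous.continuousOn).div
      hEs.continuous.continuousOn fun p hp => (hpos p hp).ne'
  · rw [hval]
    exact neg_nonpos.2 (sq_nonneg _)
  · rw [hval]
    simp
end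
end

section
/- Let V ⊆ ℝ² be open with coordinates (u,v), and let f, ν : V → ℝ³ be smooth with |ν| = 1 and ⟨f_u, ν⟩ = ⟨f_v, ν⟩ = 0 on V (f is a frontal with unit normal ν). Suppose f_u(q) ≠ 0 for all q ∈ V, and suppose there exists t ∈ ℝ such that the parallel surface f_t = f + tν is an immersion on V and (u,v) is a curvature line coordinate system for f_t, i.e. ⟨(f_t)_u, (f_t)_v⟩ = 0 on V and, at every point of V, ν_u is linearly dependent with (f_t)_u and ν_v is linearly dependent with (f_t)_v. Then at every singular point q ∈ V of f (a point where df_q is not injective) one has f_v(q) = 0. -/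
noncomputable section

open Matrix Set
open scoped ContDiff

/-- if `(u,v)` is a curvature line coordinate system for a parallel surface
`f + tν` of a frontal `f` with `f_u ≠ 0`, then `f_v` vanishes at every singular point
of `f`. -/
theorem stmt17 (V : Set (ℝ × ℝ)) (hV : IsOpen V)
    (f nu : ℝ × ℝ → V3)
    (hf : ContDiff ℝ ∞ f) (hnu : ContDiff ℝ ∞ nu)
    (hunit : ∀ q ∈ V, dot (nu q) (nu q) = 1)
    (hperp1 : ∀ q ∈ V, dot (Du f q) (nu q) = 0)
    (hperp2 : ∀ q ∈ V, dot (Dv f q) (nu q) = 0)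
    (hfu : ∀ q ∈ V, Du f q ≠ 0)
    (t : ℝ)
    (himm : ∀ q ∈ V, ∀ a b : ℝ,
      a • Du (fun x => f x + t • nu x) q + b • Dv (fun x => f x + t • nu x) q = 0 →
        a = 0 ∧ b = 0)
    (hortho : ∀ q ∈ V,
      dot (Du (fun x => f x + t • nu x) q) (Dv (fun x => f x + t • nu x) q) = 0)
    (hcl1 : ∀ q ∈ V, ∃ c : ℝ, Du nu q = c • Du (fun x => f x + t • nu x) q)
    (hcl2 : ∀ q ∈ V, ∃ c : ℝ, Dv nu q = c • Dv (fun x => f x + t • nu x) q) :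
    ∀ q ∈ V, (∃ a b : ℝ, (a, b) ≠ ((0 : ℝ), (0 : ℝ)) ∧ a • Du f q + b • Dv f q = 0) →
      Dv f q = 0 := by
  intro q hq ⟨a, b, hab, h0⟩
  have hfd : DifferentiableAt ℝ f q := (hf.differentiable (by simp)) q
  have hnd : DifferentiableAt ℝ nu q := (hnu.differentiable (by simp)) q
  have hfd' : fderiv ℝ (fun x => f x + t • nu x) q = fderiv ℝ f q + t • fderiv ℝ nu q := by
    exact (hfd.hasFDerivAt.add (hnd.hasFDerivAt.const_smul t)).fderiv
  have hu : Du (fun x => f x + t • nu x) q = Du f q + t • Du nu q := by simp [Du, hfd']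
  have hv : Dv (fun x => f x + t • nu x) q = Dv f q + t • Dv nu q := by simp [Dv, hfd']
  obtain ⟨c, hc⟩ := hcl1 q hq
  obtain ⟨d, hd⟩ := hcl2 q hq
  have hi := himm q hq
  set P := Du (fun x => f x + t • nu x) q
  set Q := Dv (fun x => f x + t • nu x) q
  have hfP : Du f q = (1 - t * c) • P := by
    rw [sub_smul, one_smul, mul_smul, ← hc, hu, add_sub_cancel_right]
  have hfQ : Dv f q = (1 - t * d) • Q := by
    rw [sub_smul, one_smul, mul_smul, ← hd, hv, add_sub_cancel_right]
  have hne : 1 - t * c ≠ 0 := fun h => hfu q hq (by rw [hfP, h, zero_smul])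
  obtain ⟨h1, h2⟩ := hi (a * (1 - t * c)) (b * (1 - t * d)) (by
    rw [mul_smul, mul_smul, ← hfP, ← hfQ, h0])
  have ha : a = 0 := (mul_eq_zero.mp h1).resolve_right hne
  have hb : b ≠ 0 := fun hb => hab (by rw [ha, hb])
  rw [hfQ, (mul_eq_zero.mp h2).resolve_left hb, zero_smul]
end
end

section
/- Let V ⊆ ℝ² be open with coordinates (u,v), and let f, ν : V → ℝ³ be smooth with |ν| = 1 and ⟨f_u, ν⟩ = ⟨f_v, ν⟩ = 0 on V, f_u ≠ 0 on V, and suppose there exists t ∈ ℝ such that f_t = f + tν is an immersion on V and (u,v) is a curvature line coordinate system for f_t. Let p ∈ V be a singular point of f that is non-degenerate, i.e. dλ(p) ≠ 0 where λ = det(f_u, f_v, ν), and suppose f_v = λ̂·ω on V for a smooth function λ̂ : V → ℝ whose zero set equals the singular set of f with dλ̂(p) ≠ 0, and a smooth map ω : V → ℝ³. Then: ω(p) ≠ 0; det(f_u, ω, ν) ≠ 0 on a neighborhood W of p (so {f_u, ω, ν} is a moving frame along f near p); ⟨f_u, ω⟩ = 0 on W; and at every point of W, ν_u is linearly dependent with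 f_u and ν_v is linearly dependent with ω. In particular e₁ = f_u/|f_u| and e₂ = ω/|ω| form a curvature line frame of the front f near p. -/
noncomputable section

open Matrix Set
open scoped ContDiff

theorem contDiff_Du {E : Type*} [NormedAddCommGroup E] [NormedSpace ℝ E] {g : ℝ × ℝ → E}
    (hg : ContDiff ℝ ∞ g) : ContDiff ℝ ∞ (Du g) :=
  (hg.fderiv_right (m := ∞) le_rfl).clm_apply contDiff_const

theorem contDiff_Dv {E : Type*} [NormedAddCommGroup E] [NormedSpace ℝ E] {g : ℝ × ℝ → E}
    (hg : ContDiff ℝ ∞ g) : ContDiff ℝ ∞ (Dv g) :=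
  (hg.fderiv_right (m := ∞) le_rfl).clm_apply contDiff_const

theorem fderiv_add_smul_apply {E F : Type*} [NormedAddCommGroup E] [NormedSpace ℝ E]
    [NormedAddCommGroup F] [NormedSpace ℝ F] {f g : E → F} {q : E}
    (hf : DifferentiableAt ℝ f q) (hg : DifferentiableAt ℝ g q) (t : ℝ) (w : E) :
    fderiv ℝ (fun x => f x + t • g x) q w = fderiv ℝ f q w + t • fderiv ℝ g q w := by
  have h := (hf.hasFDerivAt.add (hg.hasFDerivAt.const_smul t)).fderiv
  have h' : fderiv ℝ (fun x => f x + t • g x) q = fderiv ℝ f q + t • fderiv ℝ g q := h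
  simp [h']

theorem contDiff_det3 {a b c : ℝ × ℝ → V3} (ha : ContDiff ℝ ∞ a) (hb : ContDiff ℝ ∞ b)
    (hc : ContDiff ℝ ∞ c) : ContDiff ℝ ∞ (fun q => det3 (a q) (b q) (c q)) := by
  have ha' := contDiff_pi.1 ha
  have hb' := contDiff_pi.1 hb
  have hc' := contDiff_pi.1 hc
  simp only [det3, Matrix.det_fin_three, Matrix.of_apply, Matrix.cons_val]
  fun_prop

theorem continuous_dot {a b : ℝ × ℝ → V3} (ha : Continuous a) (hb : Continuous b) :
    Continuous (fun q => dot (a q) (b q)) := by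
  simp only [dot]
  fun_prop

theorem det3_smul_middle (s : ℝ) (a b c : V3) : det3 a (s • b) c = s * det3 a b c := by
  simp only [det3, Matrix.det_fin_three, Matrix.of_apply, Matrix.cons_val, Pi.smul_apply,
    smul_eq_mul]
  ring

theorem det3_zero_middle (a c : V3) : det3 a 0 c = 0 := by
  simpa using det3_smul_middle 0 a 0 c

theorem dot_smul_left (s : ℝ) (a b : V3) : dot (s • a) b = s * dot a b := by
  simp [dot]

theorem dot_smul_right (s : ℝ) (a b : V3) : dot a (s • b) = s * dot a b := by
  simp [dot]

theorem dot_self_pos {a : V3} (ha : a ≠ 0) : 0 < dot a a := by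
  have h : 0 ≤ dot a a := by
    simp only [dot, dotProduct]
    exact Finset.sum_nonneg fun i _ => mul_self_nonneg (a i)
  exact h.lt_of_ne fun h0 => ha (dotProduct_self_eq_zero.1 h0.symm)

theorem dot_normalize_self {a : V3} (ha : a ≠ 0) :
    dot ((nrm a)⁻¹ • a) ((nrm a)⁻¹ • a) = 1 := by
  have h := dot_self_pos ha
  have h0 : nrm a ≠ 0 := (Real.sqrt_pos.2 h).ne'
  have h1 : nrm a * nrm a = dot a a := Real.mul_self_sqrt h.le
  rw [dot_smul_left, dot_smul_right, ← h1]
  field_simp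

/-- If `x` is proportional to `y + t • x` and `y ≠ 0`, then `x` is proportional to `y`. -/
theorem exists_smul_of_smul_add {E : Type*} [AddCommGroup E] [Module ℝ E] {x y : E} {t c : ℝ}
    (h : x = c • (y + t • x)) (hy : y ≠ 0) : ∃ d : ℝ, x = d • y := by
  have h1 : (1 - c * t) • x = c • y := by
    linear_combination (norm := module) h
  by_cases hc : 1 - c * t = 0
  · rw [hc, zero_smul] at h1
    have hc0 : c = 0 := (smul_eq_zero.1 h1.symm).resolve_right hy
    simp [hc0] at hc
  · exact ⟨(1 - c * t)⁻¹ * c, by rw [mul_smul, ← h1, inv_smul_smul₀ hc]⟩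

/-- A continuous map vanishing off the zero set of `lam` near `q` vanishes at `q`, provided
`lam` has nonzero differential there. -/
theorem eq_zero_of_fderiv_ne_zero {E F : Type*} [NormedAddCommGroup E] [NormedSpace ℝ E]
    [NormedAddCommGroup F] {lam : E → ℝ} {G : E → F} {V : Set E} {q : E}
    (hV : IsOpen V) (hq : q ∈ V) (hd : fderiv ℝ lam q ≠ 0) (hG : Continuous G)
    (h : ∀ x ∈ V, lam x ≠ 0 → G x = 0) : G q = 0 := by
  by_contra hne
  have h0 : lam =ᶠ[nhds q] fun _ => 0 := by
    filter_upwards [hV.mem_nhds hq, hG.continuousAt.eventually_ne hne] with x hx hGx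
    by_contra hl
    exact hGx (h x hx hl)
  exact hd (by rw [h0.fderiv_eq]; simp)

/-- near a non-degenerate singular point of a front, writing `f_v = λ̂·om`, the
pair `e₁ = f_u/|f_u|`, `e₂ = om/|om|` is a curvature line frame: `om(p) ≠ 0`,
`det(f_u, om, ν) ≠ 0`, `⟨f_u, om⟩ = 0`, `ν_u ∥ f_u` and `ν_v ∥ om` near `p`, and `e₁, e₂` form
an orthonormal tangent frame. -/
theorem stmt18 (V : Set (ℝ × ℝ)) (hV : IsOpen V)
    (f nu : ℝ × ℝ → V3)
    (hf : ContDiff ℝ ∞ f) (hnu : ContDiff ℝ ∞ nu)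
    (hunit : ∀ q ∈ V, dot (nu q) (nu q) = 1)
    (hperp1 : ∀ q ∈ V, dot (Du f q) (nu q) = 0)
    (hperp2 : ∀ q ∈ V, dot (Dv f q) (nu q) = 0)
    (hfu : ∀ q ∈ V, Du f q ≠ 0)
    (t : ℝ)
    (himm : ∀ q ∈ V, ∀ a b : ℝ,
      a • Du (fun x => f x + t • nu x) q + b • Dv (fun x => f x + t • nu x) q = 0 →
        a = 0 ∧ b = 0)
    (hortho : ∀ q ∈ V,
      dot (Du (fun x => f x + t • nu x) q) (Dv (fun x => f x + t • nu x) q) = 0)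
    (hcl1 : ∀ q ∈ V, ∃ c : ℝ, Du nu q = c • Du (fun x => f x + t • nu x) q)
    (hcl2 : ∀ q ∈ V, ∃ c : ℝ, Dv nu q = c • Dv (fun x => f x + t • nu x) q)
    (p : ℝ × ℝ) (hp : p ∈ V)
    (hsing : ∃ a b : ℝ, (a, b) ≠ ((0 : ℝ), (0 : ℝ)) ∧ a • Du f p + b • Dv f p = 0)
    (hnd : fderiv ℝ (fun q => det3 (Du f q) (Dv f q) (nu q)) p ≠ 0)
    (lam : ℝ × ℝ → ℝ) (om : ℝ × ℝ → V3)
    (hlam : ContDiff ℝ ∞ lam) (hom : ContDiff ℝ ∞ om)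
    (hfac : ∀ q ∈ V, Dv f q = lam q • om q)
    (hzero : ∀ q ∈ V, (lam q = 0 ↔
      ∃ a b : ℝ, (a, b) ≠ ((0 : ℝ), (0 : ℝ)) ∧ a • Du f q + b • Dv f q = 0))
    (hdlam : fderiv ℝ lam p ≠ 0) :
    om p ≠ 0 ∧
    ∃ W : Set (ℝ × ℝ), IsOpen W ∧ p ∈ W ∧ W ⊆ V ∧
      ∀ q ∈ W,
        det3 (Du f q) (om q) (nu q) ≠ 0 ∧
        dot (Du f q) (om q) = 0 ∧
        (∃ c : ℝ, Du nu q = c • Du f q) ∧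
        (∃ c : ℝ, Dv nu q = c • om q) ∧
        dot ((nrm (Du f q))⁻¹ • Du f q) ((nrm (Du f q))⁻¹ • Du f q) = 1 ∧
        dot ((nrm (om q))⁻¹ • om q) ((nrm (om q))⁻¹ • om q) = 1 ∧
        dot ((nrm (Du f q))⁻¹ • Du f q) ((nrm (om q))⁻¹ • om q) = 0 ∧
        dot ((nrm (Du f q))⁻¹ • Du f q) (nu q) = 0 ∧
        dot ((nrm (om q))⁻¹ • om q) (nu q) = 0 := by
  have hDf : Differentiable ℝ f := hf.differentiable (by simp)
  have hDnu : Differentiable ℝ nu := hnu.differentiable (by simp)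
  have hu : ∀ q, Du (fun x => f x + t • nu x) q = Du f q + t • Du nu q := fun q =>
    fderiv_add_smul_apply (hDf q) (hDnu q) t _
  have hv : ∀ q, Dv (fun x => f x + t • nu x) q = Dv f q + t • Dv nu q := fun q =>
    fderiv_add_smul_apply (hDf q) (hDnu q) t _
  simp only [hu, hv] at hortho hcl1 hcl2
  have hD : ContDiff ℝ ∞ (fun q => det3 (Du f q) (om q) (nu q)) :=
    contDiff_det3 (contDiff_Du hf) hom hnu
  have hlp : lam p = 0 := (hzero p hp).2 hsing
  have hdet : det3 (Du f p) (om p) (nu p) ≠ 0 := by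
    intro h0
    apply hnd
    have he : (fun q => det3 (Du f q) (Dv f q) (nu q)) =ᶠ[nhds p]
        (fun q => lam q * det3 (Du f q) (om q) (nu q)) := by
      filter_upwards [hV.mem_nhds hp] with q hq
      rw [hfac q hq, det3_smul_middle]
    rw [he.fderiv_eq, fderiv_fun_mul (hlam.differentiable (by simp) p)
      (hD.differentiable (by simp) p), hlp, h0]
    simp
  have hom0 : ∀ q, det3 (Du f q) (om q) (nu q) ≠ 0 → om q ≠ 0 := by
    intro q hq h0
    exact hq (by rw [h0, det3_zero_middle])
  have hdc : Continuous (fderiv ℝ lam) := hlam.continuous_fderiv (by simp)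
  have hcu : Continuous (Du f) := (contDiff_Du hf).continuous
  have hcnv : Continuous (Dv nu) := (contDiff_Dv hnu).continuous
  refine ⟨hom0 p hdet, V ∩ ({q | det3 (Du f q) (om q) (nu q) ≠ 0} ∩ {q | fderiv ℝ lam q ≠ 0}),
    hV.inter ((isOpen_ne_fun hD.continuous continuous_const).inter
      (isOpen_ne_fun hdc continuous_const)), ⟨hp, hdet, hdlam⟩, inter_subset_left, ?_⟩
  rintro q ⟨hq, hdq, hlq⟩
  have hfom : dot (Du f q) (om q) = 0 := by
    refine eq_zero_of_fderiv_ne_zero (G := fun x => dot (Du f x) (om x)) hV hq hlq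
      (continuous_dot hcu hom.continuous) ?_
    intro x hx hlx
    obtain ⟨c, hc⟩ := hcl1 x hx
    obtain ⟨d, hd⟩ := hcl2 x hx
    have e1 : Du f x = (1 - t * c) • (Du f x + t • Du nu x) := by
      linear_combination (norm := module) (-t) • hc
    have e2 : Dv f x = (1 - t * d) • (Dv f x + t • Dv nu x) := by
      linear_combination (norm := module) (-t) • hd
    have e3 : dot (Du f x) (Dv f x) = 0 := by
      rw [e1, e2, dot_smul_left, dot_smul_right, hortho x hx]
      simp
    rw [hfac x hx, dot_smul_right] at e3
    exact (mul_eq_zero.1 e3).resolve_left hlx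
  have homnu : dot (om q) (nu q) = 0 := by
    refine eq_zero_of_fderiv_ne_zero (G := fun x => dot (om x) (nu x)) hV hq hlq
      (continuous_dot hom.continuous hnu.continuous) ?_
    intro x hx hlx
    have e := hperp2 x hx
    rw [hfac x hx, dot_smul_left] at e
    exact (mul_eq_zero.1 e).resolve_left hlx
  have hpar : dot (om q) (om q) • Dv nu q - dot (Dv nu q) (om q) • om q = 0 := by
    refine eq_zero_of_fderiv_ne_zero
      (G := fun x => dot (om x) (om x) • Dv nu x - dot (Dv nu x) (om x) • om x)
      (V := V ∩ {x | det3 (Du f x) (om x) (nu x) ≠ 0})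
      (hV.inter (isOpen_ne_fun hD.continuous continuous_const)) ⟨hq, hdq⟩ hlq
      (((continuous_dot hom.continuous hom.continuous).smul hcnv).sub
        ((continuous_dot hcnv hom.continuous).smul hom.continuous)) ?_
    rintro x ⟨hx, hdx⟩ hlx
    obtain ⟨c, hc⟩ := hcl2 x hx
    have hfv : Dv f x ≠ 0 := by
      rw [hfac x hx]
      exact smul_ne_zero hlx (hom0 x hdx)
    obtain ⟨d, hd⟩ := exists_smul_of_smul_add hc hfv
    rw [hfac x hx] at hd
    simp only [hd, dot_smul_left]
    module
  obtain ⟨c, hc⟩ := hcl1 q hq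
  have hoq := dot_self_pos (hom0 q hdq)
  refine ⟨hdq, hfom, exists_smul_of_smul_add hc (hfu q hq),
    ⟨(dot (om q) (om q))⁻¹ * dot (Dv nu q) (om q), ?_⟩,
    dot_normalize_self (hfu q hq), dot_normalize_self (hom0 q hdq), ?_, ?_, ?_⟩
  · rw [mul_smul, ← sub_eq_zero.1 hpar, inv_smul_smul₀ hoq.ne']
  · rw [dot_smul_left, dot_smul_right, hfom]
    simp
  · rw [dot_smul_left, hperp1 q hq, mul_zero]
  · rw [dot_smul_left, homnu, mul_zero]
end
end

section
/- Let I ⊆ ℝ be open, let θ, l, ρ, k : I → ℝ be smooth with ρ'(u) = k(u)·l(u) and |k(u)| < 1 for all u ∈ I, set e(u) = (cos θ(u), sin θ(u)) and n(u) = (−sin θ(u), cos θ(u)), and let γ : I → ℝ² be smooth with γ'(u) = l(u)·e(u) for all u (so γ is a frontal plane curve). Define F : I × ℝ² → ℝ by F(u, X) = |X − γ(u)|² − ρ(u)², and define X_±(u) = γ(u) − ρ(u)k(u)·e(u) ± ρ(u)·√(1 − k(u)²)·n(u). Then: (i) for every u ∈ I, F(u, X_±(u)) = 0 and (∂F/∂u)(u,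 X_±(u)) = 0; (ii) conversely, for every u ∈ I with l(u) ≠ 0 and every X ∈ ℝ², if F(u, X) = 0 and (∂F/∂u)(u, X) = 0 then X = X₊(u) or X = X₋(u). In other words, the envelope of the one-parameter family of circles of center γ(u) and radius |ρ(u)| consists exactly of the two curves X₊ and X₋. -/
noncomputable section

open Matrix Set
open scoped ContDiff

/-- The derivative in the parameter of the circle family centred on a frontal curve `γ`. -/
theorem hasDerivAt_circleFamily {γ : ℝ → ℝ × ℝ} {ρ : ℝ → ℝ} {u l k c s : ℝ}
    (hγ : HasDerivAt γ (l • ((c, s) : ℝ × ℝ)) u) (hρ : HasDerivAt ρ (k * l) u) (X : ℝ × ℝ) :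
    HasDerivAt (fun t => (X.1 - (γ t).1) ^ 2 + (X.2 - (γ t).2) ^ 2 - ρ t ^ 2)
      (-2 * l * ((X.1 - (γ u).1) * c + (X.2 - (γ u).2) * s + ρ u * k)) u := by
  have h1 : HasDerivAt (fun t => (γ t).1) (l * c) u := by
    exact hasFDerivAt_fst.comp_hasDerivAt u hγ
  have h2 : HasDerivAt (fun t => (γ t).2) (l * s) u := by
    exact hasFDerivAt_snd.comp_hasDerivAt u hγ
  refine ((((h1.const_sub X.1).pow 2).add ((h2.const_sub X.2).pow 2)).sub
    (hρ.pow 2)).congr_deriv ?_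
  push_cast
  ring

/-- the envelope of the family of circles centered at a frontal plane curve
`γ` with radius `ρ` (with `ρ' = k·l`, `|k| < 1`) consists exactly of the two curves
`X_± = γ − ρk·e ± ρ√(1−k²)·n`. -/
theorem stmt19 (I : Set ℝ) (hI : IsOpen I)
    (θ l ρ k : ℝ → ℝ)
    (hθ : ContDiff ℝ ∞ θ) (hl : ContDiff ℝ ∞ l) (hρ : ContDiff ℝ ∞ ρ)
    (hkc : ContDiff ℝ ∞ k)
    (γ : ℝ → ℝ × ℝ) (hγ : ContDiff ℝ ∞ γ)
    (hρ' : ∀ u ∈ I, deriv ρ u = k u * l u)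
    (hk1 : ∀ u ∈ I, |k u| < 1)
    (hγ' : ∀ u ∈ I, deriv γ u = l u • ((Real.cos (θ u), Real.sin (θ u)) : ℝ × ℝ))
    (F : ℝ → ℝ × ℝ → ℝ)
    (hF : ∀ u : ℝ, ∀ X : ℝ × ℝ,
      F u X = (X.1 - (γ u).1) ^ 2 + (X.2 - (γ u).2) ^ 2 - ρ u ^ 2)
    (Xp Xm : ℝ → ℝ × ℝ)
    (hXp : ∀ u : ℝ, Xp u = γ u - (ρ u * k u) • ((Real.cos (θ u), Real.sin (θ u)) : ℝ × ℝ)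
      + (ρ u * Real.sqrt (1 - k u ^ 2)) • ((-Real.sin (θ u), Real.cos (θ u)) : ℝ × ℝ))
    (hXm : ∀ u : ℝ, Xm u = γ u - (ρ u * k u) • ((Real.cos (θ u), Real.sin (θ u)) : ℝ × ℝ)
      - (ρ u * Real.sqrt (1 - k u ^ 2)) • ((-Real.sin (θ u), Real.cos (θ u)) : ℝ × ℝ)) :
    (∀ u ∈ I,
      F u (Xp u) = 0 ∧ deriv (fun s => F s (Xp u)) u = 0 ∧
      F u (Xm u) = 0 ∧ deriv (fun s => F s (Xm u)) u = 0) ∧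
    (∀ u ∈ I, l u ≠ 0 → ∀ X : ℝ × ℝ,
      F u X = 0 → deriv (fun s => F s X) u = 0 → X = Xp u ∨ X = Xm u) := by
  have hd : ∀ u ∈ I, ∀ X : ℝ × ℝ, deriv (fun s => F s X) u =
      -2 * l u * ((X.1 - (γ u).1) * Real.cos (θ u) + (X.2 - (γ u).2) * Real.sin (θ u)
        + ρ u * k u) := by
    intro u hu X
    have h1 := (hγ.differentiable (by simp) u).hasDerivAt
    have h2 := (hρ.differentiable (by simp) u).hasDerivAt
    rw [hγ' u hu] at h1
    rw [hρ' u hu] at h2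
    simpa only [hF] using (hasDerivAt_circleFamily h1 h2 X).deriv
  have hs : ∀ u ∈ I, Real.sqrt (1 - k u ^ 2) ^ 2 = 1 - k u ^ 2 := by
    intro u hu
    exact Real.sq_sqrt (sub_nonneg.2 ((sq_lt_one_iff_abs_lt_one _).2 (hk1 u hu)).le)
  refine ⟨fun u hu => ?_, fun u hu hlu X hX hdX => ?_⟩
  · have hsu := hs u hu
    have hcs := Real.sin_sq_add_cos_sq (θ u)
    rw [hd u hu, hd u hu, hF, hF, hXp, hXm]
    simp only [Prod.fst_add, Prod.snd_add, Prod.fst_sub, Prod.snd_sub, Prod.smul_mk, smul_eq_mul]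
    generalize Real.sqrt (1 - k u ^ 2) = r at *
    generalize Real.sin (θ u) = s at *
    generalize Real.cos (θ u) = c at *
    refine ⟨?_, ?_, ?_, ?_⟩
    · linear_combination (ρ u ^ 2 * (k u ^ 2 + r ^ 2)) * hcs + ρ u ^ 2 * hsu
    · linear_combination (2 * l u * ρ u * k u) * hcs
    · linear_combination (ρ u ^ 2 * (k u ^ 2 + r ^ 2)) * hcs + ρ u ^ 2 * hsu
    · linear_combination (2 * l u * ρ u * k u) * hcs
  · have hsu := hs u hu
    have hcs := Real.sin_sq_add_cos_sq (θ u)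
    rw [hd u hu] at hdX
    rw [hF] at hX
    have ha := (mul_eq_zero.1 hdX).resolve_left (mul_ne_zero (by norm_num) hlu)
    rw [hXp, hXm]
    simp only [Prod.ext_iff, Prod.fst_add, Prod.snd_add, Prod.fst_sub, Prod.snd_sub, Prod.smul_mk,
      smul_eq_mul]
    generalize Real.sqrt (1 - k u ^ 2) = r at *
    generalize Real.sin (θ u) = s at *
    generalize Real.cos (θ u) = c at *
    set x := X.1 - (γ u).1 with hx
    set y := X.2 - (γ u).2 with hy
    have hb : (-x * s + y * c) ^ 2 = (ρ u * r) ^ 2 := by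
      linear_combination (x ^ 2 + y ^ 2) * hcs + hX - ρ u ^ 2 * hsu
        - (x * c + y * s - ρ u * k u) * ha
    rcases sq_eq_sq_iff_eq_or_eq_neg.1 hb with h | h
    · left
      constructor
      · linear_combination -hx - x * hcs + c * ha - s * h
      · linear_combination -hy - y * hcs + s * ha + c * h
    · right
      constructor
      · linear_combination -hx - x * hcs + c * ha - s * h
      · linear_combination -hy - y * hcs + s * ha + c * h
end
end
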